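/- arXiv:2001.06111 — 4 statements merged into one kernel-verified Lean document; each statement's English description precedes it below -/
import Mathlib

section
/- Given a bipartite graph G and a priority p on G, every butterfly of G is contained in one and exactly one maximal priority-obeyed bloom of G. -/
/-- A bipartite graph: two disjoint finite vertex layers `U` and `L`,
and an edge set `E ⊆ U × L`. -/
structure BipartiteGraph (V : Type*) [DecidableEq V] where
  U : Finset V
  L : Finset V
  E : Finset (V × V)
  disj : Disjoint U L
  mem_of_edge : ∀ e ∈ E, e.1 ∈ U ∧ e.2 ∈ L

variable {V : Type*} [DecidableEq V]

namespace BipartiteGraph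

/-- The set of neighbors of a vertex. -/
def nbrs (G : BipartiteGraph V) (x : V) : Finset V :=
  ((G.E.filter fun e => e.1 = x).image Prod.snd) ∪
    ((G.E.filter fun e => e.2 = x).image Prod.fst)

/-- The degree of a vertex: its number of neighbors. -/
def deg (G : BipartiteGraph V) (x : V) : ℕ := (G.nbrs x).card

end BipartiteGraph

/-- The butterflies all four of whose edges lie in the edge set `F`: an unordered
pair of first-layer vertices together with an unordered pair of second-layer
vertices, all four cross pairs being edges of `F`. -/
def butterfliesIn (F : Finset (V × V)) : Finset (Finset V × Finset V) :=
  (((F.image Prod.fst).powersetCard 2) ×ˢ ((F.image Prod.snd).powersetCard 2)).filter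
    fun P => ∀ a ∈ P.1, ∀ c ∈ P.2, (a, c) ∈ F

/-- The butterfly support of an edge `e` w.r.t. an edge set `F`: the number of
butterflies of `F` one of whose four edges is `e`. -/
def btfSupport (F : Finset (V × V)) (e : V × V) : ℕ :=
  ((butterfliesIn F).filter fun P => e.1 ∈ P.1 ∧ e.2 ∈ P.2).card

/-- The edge set of a bloom with dominant (two-vertex) layer `{a, b}` and
other-layer vertex set `S`. If `flip = false` the dominant pair lies in the
upper layer; if `flip = true` it lies in the lower layer. -/
def bloomEdges (a b : V) (S : Finset V) (flip : Bool) : Finset (V × V) :=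
  if flip then S.image (fun s => (s, a)) ∪ S.image (fun s => (s, b))
  else S.image (fun s => (a, s)) ∪ S.image (fun s => (b, s))

/-- A bloom of `G`: a `(2, k)`-biclique with `k = S.card ≥ 1`, consisting of a
pair of distinct vertices `{a, b}` in one layer both adjacent to every vertex of
the set `S` of the other layer. -/
structure Bloom (G : BipartiteGraph V) where
  a : V
  b : V
  S : Finset V
  flip : Bool
  ne : a ≠ b
  nonempty : S.Nonempty
  sub : bloomEdges a b S flip ⊆ G.E

/-- The edge set of a bloom. -/
def Bloom.edges {G : BipartiteGraph V} (B : Bloom G) : Finset (V × V) :=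
  bloomEdges B.a B.b B.S B.flip

/-- A priority on `G`: an injective integer labelling of the vertices of `G`
which is strictly monotone with respect to degrees. -/
def IsPriority (G : BipartiteGraph V) (p : V → ℤ) : Prop :=
  Set.InjOn p ↑(G.U ∪ G.L) ∧
    ∀ x ∈ G.U ∪ G.L, ∀ y ∈ G.U ∪ G.L, G.deg y < G.deg x → p y < p x

/-- A bloom is priority-obeyed if its vertex with the largest priority lies in
the dominant (two-vertex) layer. -/
def Bloom.PriorityObeyed {G : BipartiteGraph V} (B : Bloom G) (p : V → ℤ) : Prop :=
  ∀ s ∈ B.S, p s < max (p B.a) (p B.b)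

/-- A maximal priority-obeyed bloom: a priority-obeyed bloom such that no bloom
whose edge set properly contains its edge set is also priority-obeyed. -/
def Bloom.IsMaxPriorityObeyed {G : BipartiteGraph V} (B : Bloom G) (p : V → ℤ) : Prop :=
  B.PriorityObeyed p ∧ ∀ B' : Bloom G, B'.PriorityObeyed p → ¬ B.edges ⊂ B'.edges

theorem mem_bloomEdges {a b x y : V} {S : Finset V} {flip : Bool} :
    (x, y) ∈ bloomEdges a b S flip ↔
      (flip = false ∧ (x = a ∨ x = b) ∧ y ∈ S) ∨ (flip = true ∧ x ∈ S ∧ (y = a ∨ y = b)) := by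
  cases flip <;> simp [bloomEdges] <;> grind

/-- If the top-priority vertex of a butterfly lies in `{a, b}`, then among the priority-obeyed
blooms containing the butterfly there is a greatest one. -/
theorem exists_greatest_priorityObeyed_bloom (G : BipartiteGraph V) (p : V → ℤ) {a b c d : V}
    (flip : Bool) (hab : a ≠ b) (hcd : c ≠ d) (hE : bloomEdges a b {c, d} flip ⊆ G.E)
    (hc : p c < max (p a) (p b)) (hd : p d < max (p a) (p b)) :
    ∃ B : Bloom G, B.PriorityObeyed p ∧ bloomEdges a b {c, d} flip ⊆ B.edges ∧
      ∀ B' : Bloom G, B'.PriorityObeyed p → bloomEdges a b {c, d} flip ⊆ B'.edges →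
        B'.edges ⊆ B.edges := by
  have mem_layers : ∀ x y, (x, y) ∈ G.E → x ∈ G.U ∪ G.L ∧ y ∈ G.U ∪ G.L := fun x y h => by
    have := G.mem_of_edge _ h
    simp_all
  obtain ⟨S, hS⟩ : ∃ S : Finset V, ∀ s,
      s ∈ S ↔ p s < max (p a) (p b) ∧ bloomEdges a b {s} flip ⊆ G.E := by
    refine ⟨(G.U ∪ G.L).filter fun s =>
      p s < max (p a) (p b) ∧ bloomEdges a b {s} flip ⊆ G.E, fun s => ?_⟩
    simp only [Finset.mem_filter, and_iff_right_iff_imp]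
    rintro ⟨-, h⟩
    cases flip
    · exact (mem_layers a s (h (by simp [mem_bloomEdges]))).2
    · exact (mem_layers s a (h (by simp [mem_bloomEdges]))).1
  have hsub : ∀ s ∈ ({c, d} : Finset V), bloomEdges a b {s} flip ⊆ bloomEdges a b {c, d} flip := by
    rintro s hs ⟨x, y⟩
    simp only [mem_bloomEdges]
    grind
  have hcS : c ∈ S := (hS c).2 ⟨hc, (hsub c (by simp)).trans hE⟩
  have hdS : d ∈ S := (hS d).2 ⟨hd, (hsub d (by simp)).trans hE⟩
  refine ⟨⟨a, b, S, flip, hab, ⟨c, hcS⟩, ?_⟩, fun s hs => ((hS s).1 hs).1, ?_, ?_⟩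
  · rintro ⟨x, y⟩ h
    rw [mem_bloomEdges] at h
    rcases h with ⟨rfl, h, hy⟩ | ⟨rfl, hx, h⟩
    · exact ((hS y).1 hy).2 (by simp [mem_bloomEdges, h])
    · exact ((hS x).1 hx).2 (by simp [mem_bloomEdges, h])
  · rintro ⟨x, y⟩ h
    simp only [Bloom.edges, mem_bloomEdges] at h ⊢
    clear hS hsub
    grind
  · rintro ⟨a', b', S', flip', hab', hne', hE'⟩ hB' hP
    simp only [Bloom.edges, Bloom.PriorityObeyed] at hB' hP ⊢
    have hdom : flip' = flip ∧ ((a' = a ∧ b' = b) ∨ (a' = b ∧ b' = a)) := by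
      cases flip
      · have h1 := hP (show (a, c) ∈ _ by simp [mem_bloomEdges])
        have h2 := hP (show (a, d) ∈ _ by simp [mem_bloomEdges])
        have h3 := hP (show (b, c) ∈ _ by simp [mem_bloomEdges])
        have h4 := hP (show (b, d) ∈ _ by simp [mem_bloomEdges])
        rw [mem_bloomEdges] at h1 h2 h3 h4
        grind
      · have h1 := hP (show (c, a) ∈ _ by simp [mem_bloomEdges])
        have h2 := hP (show (d, a) ∈ _ by simp [mem_bloomEdges])
        have h3 := hP (show (c, b) ∈ _ by simp [mem_bloomEdges])
        have h4 := hP (show (d, b) ∈ _ by simp [mem_bloomEdges])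
        rw [mem_bloomEdges] at h1 h2 h3 h4
        grind
    obtain ⟨rfl, hdom⟩ := hdom
    have hS' : ∀ s ∈ S', s ∈ S := by
      intro s hs
      refine (hS s).2 ⟨by have := hB' s hs; grind, ?_⟩
      rintro ⟨x, y⟩ h
      apply hE'
      rw [mem_bloomEdges] at h ⊢
      grind
    rintro ⟨x, y⟩ h
    rw [mem_bloomEdges] at h ⊢
    grind

/-- given a priority `p` on `G`, every butterfly of `G` is
contained in one and exactly one maximal priority-obeyed bloom of `G`
(uniqueness is at the level of the blooms' edge sets). -/
theorem butterfly_in_unique_max_priority_bloom (G : BipartiteGraph V) (p : V → ℤ)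
    (hp : IsPriority G p) (P : Finset V × Finset V) (hP : P ∈ butterfliesIn G.E) :
    (∃ B : Bloom G, B.IsMaxPriorityObeyed p ∧ P.1 ×ˢ P.2 ⊆ B.edges) ∧
      ∀ B₁ B₂ : Bloom G, B₁.IsMaxPriorityObeyed p → B₂.IsMaxPriorityObeyed p →
        P.1 ×ˢ P.2 ⊆ B₁.edges → P.1 ×ˢ P.2 ⊆ B₂.edges → B₁.edges = B₂.edges := by
  simp only [butterfliesIn, Finset.mem_filter, Finset.mem_product, Finset.mem_powersetCard,
    Finset.card_eq_two] at hP
  obtain ⟨⟨⟨-, a, b, hab, hP₁⟩, -, c, d, hcd, hP₂⟩, hE⟩ := hP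
  obtain ⟨B, hB, hPB, hmax⟩ : ∃ B : Bloom G, B.PriorityObeyed p ∧ P.1 ×ˢ P.2 ⊆ B.edges ∧
      ∀ B' : Bloom G, B'.PriorityObeyed p → P.1 ×ˢ P.2 ⊆ B'.edges → B'.edges ⊆ B.edges := by
    have hPE : P.1 ×ˢ P.2 ⊆ G.E := fun e he =>
      hE e.1 (Finset.mem_product.1 he).1 e.2 (Finset.mem_product.1 he).2
    have hupper : P.1 ×ˢ P.2 = bloomEdges a b {c, d} false := by
      ext ⟨x, y⟩
      simp [mem_bloomEdges, hP₁, hP₂]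
    have hlower : P.1 ×ˢ P.2 = bloomEdges c d {a, b} true := by
      ext ⟨x, y⟩
      simp [mem_bloomEdges, hP₁, hP₂]
    have hne : ∀ x ∈ P.1, ∀ y ∈ P.2, p x ≠ p y := by
      intro x hx y hy hxy
      obtain ⟨hxU, hyL⟩ := G.mem_of_edge _ (hE x hx y hy)
      have : x = y := hp.1 (by simp [hxU]) (by simp [hyL]) hxy
      exact Finset.disjoint_left.1 G.disj hxU (this ▸ hyL)
    have hac := hne a (by simp [hP₁]) c (by simp [hP₂])
    have had := hne a (by simp [hP₁]) d (by simp [hP₂])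
    have hbc := hne b (by simp [hP₁]) c (by simp [hP₂])
    have hbd := hne b (by simp [hP₁]) d (by simp [hP₂])
    by_cases htop : p c < max (p a) (p b) ∧ p d < max (p a) (p b)
    · rw [hupper] at hPE ⊢
      exact exists_greatest_priorityObeyed_bloom G p false hab hcd hPE htop.1 htop.2
    · rw [hlower] at hPE ⊢
      exact exists_greatest_priorityObeyed_bloom G p true hcd hab hPE (by grind) (by grind)
  have heq : ∀ B' : Bloom G, B'.IsMaxPriorityObeyed p → P.1 ×ˢ P.2 ⊆ B'.edges →
      B'.edges = B.edges := fun B' hB' hPB' =>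
    eq_of_le_of_not_lt (hmax B' hB'.1 hPB') (hB'.2 B hB)
  refine ⟨⟨B, ⟨hB, fun B' hB' hlt => ?_⟩, hPB⟩, fun B₁ B₂ h₁ h₂ hP₁ hP₂ =>
    (heq B₁ h₁ hP₁).trans (heq B₂ h₂ hP₂).symm⟩
  exact hlt.2 (hmax B' hB' (hPB.trans hlt.1))
end

section
/- Given a bipartite graph G and a priority p on G, for every edge (u,v) ∈ E(G) with p(u) > p(v), the number of priority-obeyed wedges of G whose start-vertex is u and whose middle-vertex is v is at most min{deg(u), deg(v)}. -/
variable {V : Type*} [DecidableEq V]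

/-- `(u, v, w)` is a wedge of `G`: `u ≠ w` lie in one layer and `v` lies in the
other layer, adjacent to both `u` and `w`. `u` is the start-vertex, `v` the
middle-vertex and `w` the end-vertex. -/
def IsWedge (G : BipartiteGraph V) (u v w : V) : Prop :=
  u ≠ w ∧ (((u, v) ∈ G.E ∧ (w, v) ∈ G.E) ∨ ((v, u) ∈ G.E ∧ (v, w) ∈ G.E))

/-- A priority-obeyed wedge: a wedge whose start-vertex has larger priority than
both its middle-vertex and its end-vertex. -/
def IsPriorityWedge (G : BipartiteGraph V) (p : V → ℤ) (u v w : V) : Prop :=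
  IsWedge G u v w ∧ p v < p u ∧ p w < p u

instance (G : BipartiteGraph V) (u v w : V) : Decidable (IsWedge G u v w) := by
  unfold IsWedge; infer_instance

instance (G : BipartiteGraph V) (p : V → ℤ) (u v w : V) :
    Decidable (IsPriorityWedge G p u v w) := by
  unfold IsPriorityWedge; infer_instance

namespace BipartiteGraph

theorem mem_nbrs {G : BipartiteGraph V} {x y : V} :
    y ∈ G.nbrs x ↔ (x, y) ∈ G.E ∨ (y, x) ∈ G.E := by
  simp [nbrs]

theorem left_mem_vertices {G : BipartiteGraph V} {x y : V} (h : (x, y) ∈ G.E) :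
    x ∈ G.U ∪ G.L :=
  Finset.mem_union_left _ (G.mem_of_edge _ h).1

theorem right_mem_vertices {G : BipartiteGraph V} {x y : V} (h : (x, y) ∈ G.E) :
    y ∈ G.U ∪ G.L :=
  Finset.mem_union_right _ (G.mem_of_edge _ h).2

end BipartiteGraph

theorem IsWedge.end_mem_nbrs {G : BipartiteGraph V} {u v w : V} (h : IsWedge G u v w) :
    w ∈ G.nbrs v :=
  BipartiteGraph.mem_nbrs.2 (h.2.elim (fun h => .inr h.2) fun h => .inl h.2)

theorem IsPriority.deg_le_of_lt {G : BipartiteGraph V} {p : V → ℤ} (hp : IsPriority G p)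
    {x y : V} (hx : x ∈ G.U ∪ G.L) (hy : y ∈ G.U ∪ G.L) (h : p x < p y) :
    G.deg x ≤ G.deg y :=
  le_of_not_gt fun hlt => lt_asymm h (hp.2 x hx y hy hlt)

/-- for every edge `(u, v)` of `G` with `p u > p v`, the number of
priority-obeyed wedges whose start-vertex is `u` and whose middle-vertex is `v`
is at most `min (deg u) (deg v)`. -/
theorem priority_wedge_count_per_edge (G : BipartiteGraph V) (p : V → ℤ)
    (hp : IsPriority G p) (u v : V) (he : (u, v) ∈ G.E ∨ (v, u) ∈ G.E)
    (hpuv : p v < p u) :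
    ((G.U ∪ G.L).filter fun w => IsPriorityWedge G p u v w).card ≤
      min (G.deg u) (G.deg v) := by
  have hcard : ((G.U ∪ G.L).filter fun w => IsPriorityWedge G p u v w).card ≤ G.deg v :=
    Finset.card_le_card fun w hw => (Finset.mem_filter.1 hw).2.1.end_mem_nbrs
  have hdeg : G.deg v ≤ G.deg u := by
    rcases he with he | he
    · exact hp.deg_le_of_lt (BipartiteGraph.right_mem_vertices he)
        (BipartiteGraph.left_mem_vertices he) hpuv
    · exact hp.deg_le_of_lt (BipartiteGraph.left_mem_vertices he)
        (BipartiteGraph.right_mem_vertices he) hpuv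
  exact le_min (hcard.trans hdeg) hcard
end

section
/- For every bipartite graph G, the total number of butterflies satisfies ⋈_G ≤ Σ_{(u,v) ∈ E(G)} Σ_{w ∈ N(v) \ {u}} max{deg(u), deg(w)}, where the inner sum runs over all neighbors w of v other than u. -/
variable {V : Type*} [DecidableEq V]

namespace BipartiteGraph

theorem snd_mem_nbrs {G : BipartiteGraph V} {a c : V} (h : (a, c) ∈ G.E) : c ∈ G.nbrs a :=
  Finset.mem_union_left _ (Finset.mem_image.2 ⟨(a, c), by simp [h], rfl⟩)

theorem fst_mem_nbrs {G : BipartiteGraph V} {a c : V} (h : (a, c) ∈ G.E) : a ∈ G.nbrs c :=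
  Finset.mem_union_right _ (Finset.mem_image.2 ⟨(a, c), by simp [h], rfl⟩)

/-- Every butterfly arises from an edge `(u, v)`, another neighbor `w` of `v`, and a
neighbor `x` of `u`. -/
theorem butterfliesIn_subset_biUnion (G : BipartiteGraph V) :
    butterfliesIn G.E ⊆ G.E.biUnion fun e => ((G.nbrs e.2).erase e.1).biUnion fun w =>
      (G.nbrs e.1).image fun x => ({e.1, w}, {e.2, x}) := by
  rintro ⟨A, C⟩ h
  simp only [butterfliesIn, Finset.mem_filter, Finset.mem_product,
    Finset.mem_powersetCard] at h
  obtain ⟨⟨⟨-, hA⟩, -, hC⟩, h⟩ := h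
  obtain ⟨u, w, huw, rfl⟩ := Finset.card_eq_two.1 hA
  obtain ⟨v, x, -, rfl⟩ := Finset.card_eq_two.1 hC
  simp only [Finset.mem_biUnion, Finset.mem_image]
  exact ⟨(u, v), h u (by simp) v (by simp), w,
    Finset.mem_erase.2 ⟨huw.symm, fst_mem_nbrs (h w (by simp) v (by simp))⟩, x,
    snd_mem_nbrs (h u (by simp) x (by simp)), rfl⟩

end BipartiteGraph

/-- the total number of butterflies of `G` is at most
`Σ_{(u,v) ∈ E(G)} Σ_{w ∈ N(v) \ {u}} max (deg u) (deg w)`. -/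
theorem butterflies_le_sum_sum_max_deg (G : BipartiteGraph V) :
    (butterfliesIn G.E).card ≤
      ∑ e ∈ G.E, ∑ w ∈ (G.nbrs e.2).erase e.1, max (G.deg e.1) (G.deg w) := by
  refine (Finset.card_le_card G.butterfliesIn_subset_biUnion).trans
    (Finset.card_biUnion_le.trans (Finset.sum_le_sum fun e _ =>
      Finset.card_biUnion_le.trans (Finset.sum_le_sum fun w _ => ?_)))
  exact Finset.card_image_le.trans (le_max_left _ _)
end

section
/- Given a bipartite graph G and a priority p on G, the total number of butterflies ⋈_G equals the sum, over all maximal priority-obeyed blooms B of G, of k_B(k_B − 1)/2, where k_B denotes the bloom number of B. -/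
variable {V : Type*} [DecidableEq V]

section

open Finset

theorem Finset.product_subset_product_iff {α β : Type*} {s s' : Finset α} {t t' : Finset β}
    (hs : s.Nonempty) (ht : t.Nonempty) : s ×ˢ t ⊆ s' ×ˢ t' ↔ s ⊆ s' ∧ t ⊆ t' := by
  obtain ⟨a, ha⟩ := hs
  obtain ⟨b, hb⟩ := ht
  refine ⟨fun h => ⟨fun x hx => ?_, fun y hy => ?_⟩, fun h => product_subset_product h.1 h.2⟩
  · exact (mem_product.1 (h (mk_mem_product hx hb))).1
  · exact (mem_product.1 (h (mk_mem_product ha hy))).2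

/-- The product of a dominant vertex set `A` with a vertex set `S` of the other layer, oriented
as in `bloomEdges`. -/
def orientedProd (flip : Bool) (A S : Finset V) : Finset (V × V) :=
  if flip then S ×ˢ A else A ×ˢ S

/-- The part of a pair of vertex sets lying in the dominant layer. -/
def dominantPart (flip : Bool) (P : Finset V × Finset V) : Finset V :=
  if flip then P.2 else P.1

/-- Every vertex of `S` has smaller priority than some vertex of `A`. -/
def Dominates (p : V → ℤ) (A S : Finset V) : Prop :=
  ∀ s ∈ S, ∃ a ∈ A, p s < p a

/-- The common neighbors of `A` having smaller priority than some vertex of `A`. -/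
def dominatedNbrs (G : BipartiteGraph V) (p : V → ℤ) (flip : Bool) (A : Finset V) : Finset V :=
  (G.E.image Prod.fst ∪ G.E.image Prod.snd).filter
    fun s => orientedProd flip A {s} ⊆ G.E ∧ ∃ a ∈ A, p s < p a

theorem bloomEdges_eq_orientedProd (a b : V) (S : Finset V) (flip : Bool) :
    bloomEdges a b S flip = orientedProd flip {a, b} S := by
  ext ⟨x, y⟩
  cases flip <;> simp [bloomEdges, orientedProd] <;> grind

theorem orientedProd_not {α : Type*} (flip : Bool) (A S : Finset α) :
    orientedProd (!flip) A S = orientedProd flip S A := by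
  cases flip <;> rfl

theorem orientedProd_dominantPart {α : Type*} (flip : Bool) (P : Finset α × Finset α) :
    orientedProd flip (dominantPart flip P) (dominantPart (!flip) P) = P.1 ×ˢ P.2 := by
  cases flip <;> rfl

theorem orientedProd_subset_iff {α : Type*} {flip : Bool} {A S A' S' : Finset α}
    (hA : A.Nonempty) (hS : S.Nonempty) :
    orientedProd flip A S ⊆ orientedProd flip A' S' ↔ A ⊆ A' ∧ S ⊆ S' := by
  cases flip <;> simp only [orientedProd, Bool.false_eq_true, if_true, if_false]
  · rw [product_subset_product_iff hA hS]
  · rw [product_subset_product_iff hS hA, and_comm]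

theorem orientedProd_mono {α : Type*} (flip : Bool) {A S A' S' : Finset α}
    (hA : A ⊆ A') (hS : S ⊆ S') :
    orientedProd flip A S ⊆ orientedProd flip A' S' := by
  cases flip
  · exact product_subset_product hA hS
  · exact product_subset_product hS hA

theorem card_orientedProd {α : Type*} (flip : Bool) (A S : Finset α) :
    (orientedProd flip A S).card = A.card * S.card := by
  cases flip <;> simp [orientedProd, mul_comm]

theorem subset_dominatedNbrs_iff {G : BipartiteGraph V} {p : V → ℤ} {flip : Bool}
    {A S : Finset V} (hA : A.Nonempty) :
    S ⊆ dominatedNbrs G p flip A ↔ orientedProd flip A S ⊆ G.E ∧ Dominates p A S := by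
  obtain ⟨a, ha⟩ := hA
  constructor
  · intro h
    refine ⟨?_, fun s hs => (mem_filter.1 (h hs)).2.2⟩
    have key := fun s (hs : s ∈ S) => (mem_filter.1 (h hs)).2.1
    rintro ⟨x, y⟩ hxy
    cases flip <;> obtain ⟨hx, hy⟩ := mem_product.1 hxy
    · exact key y hy (mk_mem_product hx (mem_singleton_self y))
    · exact key x hx (mk_mem_product (mem_singleton_self x) hy)
  · rintro ⟨hE, hD⟩ s hs
    refine mem_filter.2 ⟨?_, (orientedProd_mono flip subset_rfl
      (singleton_subset_iff.2 hs)).trans hE, hD s hs⟩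
    cases flip
    · exact mem_union_right _ (mem_image_of_mem Prod.snd (hE (mk_mem_product ha hs)))
    · exact mem_union_left _ (mem_image_of_mem Prod.fst (hE (mk_mem_product hs ha)))

theorem Dominates.not_dominates {α : Type*} {p : α → ℤ} {A S : Finset α} (h : Dominates p A S)
    (hA : A.Nonempty) : ¬ Dominates p S A := by
  intro h'
  obtain ⟨m, hm, hmax⟩ := exists_max_image A p hA
  obtain ⟨s, hs, hms⟩ := h' m hm
  obtain ⟨a, ha, hsa⟩ := h s hs
  have := hmax a ha
  omega

theorem Dominates.mono_right {α : Type*} {p : α → ℤ} {A S S' : Finset α} (h : Dominates p A S)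
    (hS : S' ⊆ S) : Dominates p A S' := fun s hs => h s (hS hs)

theorem dominates_or_dominates {α : Type*} {p : α → ℤ} {A S : Finset α} (hA : A.Nonempty)
    (hS : S.Nonempty) (hne : ∀ a ∈ A, ∀ s ∈ S, p a ≠ p s) :
    Dominates p A S ∨ Dominates p S A := by
  obtain ⟨m, hm, hmax⟩ := exists_max_image A p hA
  obtain ⟨n, hn, hnmax⟩ := exists_max_image S p hS
  rcases lt_or_gt_of_ne (hne m hm n hn) with h | h
  · exact Or.inr fun a ha => ⟨n, hn, (hmax a ha).trans_lt h⟩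
  · exact Or.inl fun s hs => ⟨m, hm, (hnmax s hs).trans_lt h⟩

theorem mem_butterfliesIn {F : Finset (V × V)} {P : Finset V × Finset V} :
    P ∈ butterfliesIn F ↔ P.1.card = 2 ∧ P.2.card = 2 ∧ P.1 ×ˢ P.2 ⊆ F := by
  simp only [butterfliesIn, mem_filter, mem_product, mem_powersetCard]
  constructor
  · rintro ⟨⟨⟨-, h1⟩, -, h2⟩, h⟩
    exact ⟨h1, h2, fun x hx => h _ (mem_product.1 hx).1 _ (mem_product.1 hx).2⟩
  · rintro ⟨h1, h2, h⟩
    obtain ⟨a, ha⟩ := card_pos.1 (h1 ▸ two_pos)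
    obtain ⟨c, hc⟩ := card_pos.1 (h2 ▸ two_pos)
    have hF : ∀ x ∈ P.1, ∀ y ∈ P.2, (x, y) ∈ F := fun x hx y hy => h (mk_mem_product hx hy)
    exact ⟨⟨⟨fun x hx => mem_image_of_mem Prod.fst (hF x hx c hc), h1⟩,
      fun y hy => mem_image_of_mem Prod.snd (hF a ha y hy), h2⟩, hF⟩

theorem mem_butterfliesIn_iff_dominantPart (flip : Bool) {F : Finset (V × V)}
    {P : Finset V × Finset V} :
    P ∈ butterfliesIn F ↔ (dominantPart flip P).card = 2 ∧ (dominantPart (!flip) P).card = 2 ∧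
      orientedProd flip (dominantPart flip P) (dominantPart (!flip) P) ⊆ F := by
  rw [mem_butterfliesIn, orientedProd_dominantPart]
  cases flip
  · rfl
  · exact and_left_comm

theorem card_butterfliesIn_orientedProd (flip : Bool) {A S : Finset V} (hA : A.card = 2) :
    (butterfliesIn (orientedProd flip A S)).card = S.card.choose 2 := by
  rw [← card_powersetCard]
  refine card_bij' (fun P _ => dominantPart (!flip) P)
    (fun Q _ => if flip then (Q, A) else (A, Q)) ?_ ?_ ?_ ?_
  · intro P hP
    obtain ⟨h1, h2, h3⟩ := (mem_butterfliesIn_iff_dominantPart flip).1 hP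
    exact mem_powersetCard.2 ⟨((orientedProd_subset_iff (card_pos.1 (h1 ▸ two_pos))
      (card_pos.1 (h2 ▸ two_pos))).1 h3).2, h2⟩
  · intro Q hQ
    obtain ⟨h1, h2⟩ := mem_powersetCard.1 hQ
    rw [mem_butterfliesIn_iff_dominantPart flip]
    cases flip <;> exact ⟨hA, h2, orientedProd_mono _ subset_rfl h1⟩
  · intro P hP
    obtain ⟨h1, h2, h3⟩ := (mem_butterfliesIn_iff_dominantPart flip).1 hP
    have h4 := eq_of_subset_of_card_le ((orientedProd_subset_iff (card_pos.1 (h1 ▸ two_pos))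
      (card_pos.1 (h2 ▸ two_pos))).1 h3).1 (hA.trans h1.symm).le
    subst h4
    cases flip <;> rfl
  · intro Q hQ
    cases flip <;> rfl

namespace Bloom

variable {G : BipartiteGraph V} {p : V → ℤ}

theorem edges_eq (B : Bloom G) : B.edges = orientedProd B.flip {B.a, B.b} B.S :=
  bloomEdges_eq_orientedProd ..

theorem priorityObeyed_iff (B : Bloom G) : B.PriorityObeyed p ↔ Dominates p {B.a, B.b} B.S := by
  simp [PriorityObeyed, Dominates]

theorem exists_of_card_eq_two (flip : Bool) {A S : Finset V} (hA : A.card = 2)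
    (hS : S.Nonempty) (h : orientedProd flip A S ⊆ G.E) :
    ∃ B : Bloom G, {B.a, B.b} = A ∧ B.S = S ∧ B.flip = flip := by
  obtain ⟨a, b, hab, rfl⟩ := card_eq_two.1 hA
  exact ⟨⟨a, b, S, flip, hab, hS, bloomEdges_eq_orientedProd a b S flip ▸ h⟩, rfl, rfl, rfl⟩

theorem IsMaxPriorityObeyed.S_eq {B : Bloom G} (hB : B.IsMaxPriorityObeyed p) :
    B.S = dominatedNbrs G p B.flip {B.a, B.b} := by
  have hne : ({B.a, B.b} : Finset V).Nonempty := insert_nonempty ..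
  have hsub : B.S ⊆ dominatedNbrs G p B.flip {B.a, B.b} :=
    (subset_dominatedNbrs_iff hne).2 ⟨B.edges_eq ▸ B.sub, B.priorityObeyed_iff.1 hB.1⟩
  obtain ⟨hE, hD⟩ := (subset_dominatedNbrs_iff (G := G) (p := p) (flip := B.flip) hne).1 subset_rfl
  obtain ⟨B', hA, hS, hf⟩ := exists_of_card_eq_two B.flip (card_pair B.ne)
    (B.nonempty.mono hsub) hE
  refine hsub.antisymm ?_
  by_contra hcon
  refine hB.2 B' (by rwa [priorityObeyed_iff, hA, hS]) ?_
  rw [ssubset_iff_subset_not_subset, B.edges_eq, B'.edges_eq, hA, hS, hf,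
    orientedProd_subset_iff hne B.nonempty, orientedProd_subset_iff hne (B.nonempty.mono hsub)]
  exact ⟨⟨subset_rfl, hsub⟩, fun h => hcon h.2⟩

theorem dominantPart_of_mem {B : Bloom G} {P : Finset V × Finset V}
    (hP : P ∈ butterfliesIn B.edges) :
    dominantPart B.flip P = {B.a, B.b} ∧ dominantPart (!B.flip) P ⊆ B.S := by
  rw [edges_eq] at hP
  obtain ⟨h1, h2, h3⟩ := (mem_butterfliesIn_iff_dominantPart B.flip).1 hP
  obtain ⟨h4, h5⟩ := (orientedProd_subset_iff (card_pos.1 (h1 ▸ two_pos))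
    (card_pos.1 (h2 ▸ two_pos))).1 h3
  exact ⟨eq_of_subset_of_card_le h4 ((card_pair B.ne).trans h1.symm).le, h5⟩

theorem PriorityObeyed.dominates_of_mem {B : Bloom G} (hB : B.PriorityObeyed p)
    {P : Finset V × Finset V} (hP : P ∈ butterfliesIn B.edges) :
    Dominates p (dominantPart B.flip P) (dominantPart (!B.flip) P) := by
  obtain ⟨h1, h2⟩ := dominantPart_of_mem hP
  rw [h1]
  exact (B.priorityObeyed_iff.1 hB).mono_right h2

/-- A butterfly lies in at most one maximal priority-obeyed bloom. -/
theorem IsMaxPriorityObeyed.edges_eq_of_mem {B B' : Bloom G} (hB : B.IsMaxPriorityObeyed p)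
    (hB' : B'.IsMaxPriorityObeyed p) {P : Finset V × Finset V}
    (hP : P ∈ butterfliesIn B.edges) (hP' : P ∈ butterfliesIn B'.edges) :
    B.edges = B'.edges := by
  have hd := hB.1.dominates_of_mem hP
  have hd' := hB'.1.dominates_of_mem hP'
  have hA := (dominantPart_of_mem hP).1
  have hA' := (dominantPart_of_mem hP').1
  by_cases hf : B'.flip = B.flip
  · rw [B.edges_eq, B'.edges_eq, hB.S_eq, hB'.S_eq, ← hA, ← hA', hf]
  · rw [Bool.eq_not_of_ne hf, Bool.not_not] at hd'
    exact absurd hd' (hd.not_dominates (hA ▸ insert_nonempty ..))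

/-- A butterfly whose vertex of largest priority lies in a given layer is contained in a maximal
priority-obeyed bloom with that dominant layer. -/
theorem exists_isMaxPriorityObeyed_of_dominates (flip : Bool) {P : Finset V × Finset V}
    (hP : P ∈ butterfliesIn G.E)
    (hd : Dominates p (dominantPart flip P) (dominantPart (!flip) P)) :
    ∃ B : Bloom G, B.IsMaxPriorityObeyed p ∧ P ∈ butterfliesIn B.edges := by
  obtain ⟨h1, h2, h3⟩ := (mem_butterfliesIn_iff_dominantPart flip).1 hP
  have hne : (dominantPart flip P).Nonempty := card_pos.1 (h1 ▸ two_pos)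
  have hne' : (dominantPart (!flip) P).Nonempty := card_pos.1 (h2 ▸ two_pos)
  have hsub := (subset_dominatedNbrs_iff hne).2 ⟨h3, hd⟩
  obtain ⟨hE, hD⟩ := (subset_dominatedNbrs_iff (G := G) (p := p) (flip := flip) hne).1 subset_rfl
  obtain ⟨B, hA, hS, hf⟩ := exists_of_card_eq_two flip h1 (hne'.mono hsub) hE
  refine ⟨B, ⟨by rwa [priorityObeyed_iff, hA, hS], fun B' hB' hss => ?_⟩, ?_⟩
  · rw [priorityObeyed_iff] at hB'
    have hsE : orientedProd B'.flip {B'.a, B'.b} B'.S ⊆ G.E := B'.edges_eq ▸ B'.sub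
    rw [ssubset_iff_subset_not_subset, B.edges_eq, B'.edges_eq, hA, hS, hf] at hss
    by_cases hf' : B'.flip = flip
    · rw [hf'] at hss hsE
      obtain ⟨h4, -⟩ := (orientedProd_subset_iff hne (hne'.mono hsub)).1 hss.1
      have h5 := eq_of_subset_of_card_le h4 ((card_pair B'.ne).trans h1.symm).le
      rw [← h5] at hss hB' hsE
      exact hss.2 (orientedProd_mono _ subset_rfl ((subset_dominatedNbrs_iff hne).2 ⟨hsE, hB'⟩))
    · rw [Bool.eq_not_of_ne hf', orientedProd_not] at hss
      obtain ⟨h4, h5⟩ := (orientedProd_subset_iff hne (hne'.mono hsub)).1 hss.1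
      have h6 := eq_of_subset_of_card_le (hsub.trans h5) ((card_pair B'.ne).trans h2.symm).le
      rw [← h6] at hB'
      exact hd.not_dominates hne (hB'.mono_right h4)
  · rw [mem_butterfliesIn_iff_dominantPart flip, B.edges_eq, hA, hS, hf]
    exact ⟨h1, h2, orientedProd_mono _ subset_rfl hsub⟩

theorem exists_isMaxPriorityObeyed (hp : IsPriority G p) {P : Finset V × Finset V}
    (hP : P ∈ butterfliesIn G.E) :
    ∃ B : Bloom G, B.IsMaxPriorityObeyed p ∧ P ∈ butterfliesIn B.edges := by
  obtain ⟨h1, h2, h3⟩ := mem_butterfliesIn.1 hP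
  have hne : ∀ a ∈ P.1, ∀ s ∈ P.2, p a ≠ p s := by
    intro a ha s hs heq
    obtain ⟨haU, hsL⟩ := G.mem_of_edge _ (h3 (mk_mem_product ha hs))
    exact disjoint_left.1 G.disj haU
      (hp.1 (mem_union_left _ haU) (mem_union_right _ hsL) heq ▸ hsL)
  rcases dominates_or_dominates (card_pos.1 (h1 ▸ two_pos)) (card_pos.1 (h2 ▸ two_pos)) hne
    with h | h
  · exact exists_isMaxPriorityObeyed_of_dominates false hP h
  · exact exists_isMaxPriorityObeyed_of_dominates true hP h

theorem card_butterfliesIn_edges (B : Bloom G) :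
    (butterfliesIn B.edges).card = (B.edges.card / 2) * (B.edges.card / 2 - 1) / 2 := by
  rw [edges_eq, card_butterfliesIn_orientedProd _ (card_pair B.ne), card_orientedProd,
    card_pair B.ne, Nat.mul_div_cancel_left _ two_pos, Nat.choose_two_right]

end Bloom

end

open scoped Classical

/-- the total number of butterflies of `G` equals the sum, over
all (edge sets of) maximal priority-obeyed blooms `B` of `G`, of
`k_B * (k_B - 1) / 2`, where the bloom number `k_B` of a bloom with edge set
`F` is `F.card / 2`. -/
theorem butterflies_eq_sum_over_max_blooms (G : BipartiteGraph V) (p : V → ℤ)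
    (hp : IsPriority G p) :
    (butterfliesIn G.E).card =
      ∑ F ∈ G.E.powerset.filter
          (fun F => ∃ B : Bloom G, B.IsMaxPriorityObeyed p ∧ B.edges = F),
        (F.card / 2) * (F.card / 2 - 1) / 2 := by
  rw [show butterfliesIn G.E = (G.E.powerset.filter
    (fun F => ∃ B : Bloom G, B.IsMaxPriorityObeyed p ∧ B.edges = F)).biUnion butterfliesIn from ?_,
    Finset.card_biUnion]
  · refine Finset.sum_congr rfl fun F hF => ?_
    obtain ⟨-, B, -, rfl⟩ := Finset.mem_filter.1 hF
    exact B.card_butterfliesIn_edges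
  · intro F hF F' hF' hne
    obtain ⟨-, B, hB, rfl⟩ := Finset.mem_filter.1 hF
    obtain ⟨-, B', hB', rfl⟩ := Finset.mem_filter.1 hF'
    exact Finset.disjoint_left.2 fun P hP hP' => hne (hB.edges_eq_of_mem hB' hP hP')
  · ext P
    simp only [Finset.mem_biUnion, Finset.mem_filter, Finset.mem_powerset]
    constructor
    · intro hP
      obtain ⟨B, hB, hPB⟩ := Bloom.exists_isMaxPriorityObeyed hp hP
      exact ⟨_, ⟨B.sub, B, hB, rfl⟩, hPB⟩
    · rintro ⟨F, ⟨hF, -⟩, hP⟩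
      obtain ⟨h1, h2, h3⟩ := mem_butterfliesIn.1 hP
      exact mem_butterfliesIn.2 ⟨h1, h2, h3.trans hF⟩
end
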